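/- arXiv:1708.08482 — 4 statements merged into one kernel-verified Lean document; each statement's English description precedes it below -/
import Mathlib

section
/- For each ε > 0 and each prime p there is a positive integer n₀ = n₀(p, ε) such that for every n ≥ n₀ and every subset A of 𝔽_p^n with density α = |A|/p^n, there exists a nonzero d ∈ 𝔽_p^n such that the density of three-term arithmetic progressions with common difference d contained in A, namely (1/p^n)·|{x ∈ 𝔽_p^n : x ∈ A, x+d ∈ A, x+2d ∈ A}|, is at least α³ − ε. -/
section GreenAux
open scoped Classical
open Finset

lemma gr_parseval {H : Type*} [AddCommGroup H] [Fintype H] (g : H → ℝ) :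
    ∑ ψ : AddChar H ℂ, ‖∑ x, (g x : ℂ) * ψ x‖ ^ 2 = (Fintype.card H : ℝ) * ∑ x, g x ^ 2 := by
  have key : ∀ ψ : AddChar H ℂ, ((‖∑ x, (g x : ℂ) * ψ x‖ ^ 2 : ℝ) : ℂ)
      = ∑ x, ∑ y, (g x : ℂ) * g y * ψ (x - y) := by
    intro ψ
    push_cast
    rw [← Complex.mul_conj', map_sum, sum_mul_sum]
    refine sum_congr rfl fun x _ => sum_congr rfl fun y _ => ?_
    rw [map_mul, Complex.conj_ofReal, ← AddChar.map_neg_eq_conj, sub_eq_add_neg,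
      AddChar.map_add_eq_mul]
    ring
  have : ((∑ ψ : AddChar H ℂ, ‖∑ x, (g x : ℂ) * ψ x‖ ^ 2 : ℝ) : ℂ)
      = (((Fintype.card H : ℝ) * ∑ x, g x ^ 2 : ℝ) : ℂ) := by
    rw [Complex.ofReal_sum]
    simp_rw [key]
    rw [sum_comm]
    push_cast
    rw [mul_sum]
    refine sum_congr rfl fun x _ => ?_
    rw [sum_comm]
    simp_rw [← mul_sum, AddChar.sum_apply_eq_ite, sub_eq_zero]
    simp
    ring
  exact_mod_cast this

lemma gr_cubic {H : Type*} [AddCommGroup H] [Fintype H] (g : H → ℝ) :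
    ∑ ψ : AddChar H ℂ, (∑ x, (g x : ℂ) * ψ x) * (∑ x, (g x : ℂ) * ψ x) *
        (∑ y, (g y : ℂ) * ψ (-(2 • y)))
      = (Fintype.card H : ℂ) * ((∑ x, ∑ d, g x * g (x + d) * g (x + 2 • d) : ℝ) : ℂ) := by
  have key : ∀ ψ : AddChar H ℂ, (∑ x, (g x : ℂ) * ψ x) * (∑ x, (g x : ℂ) * ψ x) *
        (∑ y, (g y : ℂ) * ψ (-(2 • y))) =
      ∑ x, ∑ y, ∑ z, (g x : ℂ) * g y * g z * ψ (z - (2 • y - x)) := by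
    intro ψ
    rw [mul_assoc, sum_mul]
    refine sum_congr rfl fun x _ => ?_
    rw [mul_comm (∑ x, (g x : ℂ) * ψ x), sum_mul_sum, mul_sum]
    refine sum_congr rfl fun y _ => ?_
    rw [mul_sum]
    refine sum_congr rfl fun z _ => ?_
    rw [show z - (2 • y - x) = x + z + -(2 • y) by abel, AddChar.map_add_eq_mul,
      AddChar.map_add_eq_mul]
    ring
  simp_rw [key]
  rw [sum_comm]
  push_cast
  rw [mul_sum]
  refine sum_congr rfl fun x _ => ?_
  rw [sum_comm, mul_sum, ← Equiv.sum_comp (Equiv.addLeft x)]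
  refine sum_congr rfl fun d _ => ?_
  rw [sum_comm]
  simp_rw [← mul_sum, AddChar.sum_apply_eq_ite, sub_eq_zero]
  have : 2 • (x + d) - x = x + 2 • d := by abel
  simp only [Equiv.coe_addLeft, this, mul_ite, mul_zero, sum_ite_eq', mem_univ, if_true]
  push_cast
  ring

lemma gr_fourier {H : Type*} [AddCommGroup H] [Fintype H] (g : H → ℝ) (hg : ∀ x, |g x| ≤ 1) :
    ∃ ψ : AddChar H ℂ, |∑ x, ∑ d, g x * g (x + d) * g (x + 2 • d)| ≤
      ‖∑ x, (g x : ℂ) * ψ x‖ * Fintype.card H := by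
  obtain ⟨ψ, hψ⟩ := Finite.exists_max (fun ψ : AddChar H ℂ => ‖∑ x, (g x : ℂ) * ψ x‖)
  refine ⟨ψ, ?_⟩
  set M := ‖∑ x, (g x : ℂ) * ψ x‖ with hM
  have hM0 : 0 ≤ M := norm_nonneg _
  have hN : (0 : ℝ) < Fintype.card H := by exact_mod_cast Fintype.card_pos
  have h1 := congrArg norm (gr_cubic g)
  rw [norm_mul, Complex.norm_natCast, Complex.norm_real, Real.norm_eq_abs] at h1
  have h2 : (Fintype.card H : ℝ) * |∑ x, ∑ d, g x * g (x + d) * g (x + 2 • d)| ≤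
      M * ((Fintype.card H : ℝ) * ∑ x, g x ^ 2) := by
    rw [← h1, ← gr_parseval, mul_sum]
    refine (norm_sum_le _ _).trans (sum_le_sum fun χ _ => ?_)
    rw [norm_mul, norm_mul, ← sq, mul_comm]
    refine mul_le_mul_of_nonneg_right ?_ (by positivity)
    have := hψ (χ⁻¹ ^ 2)
    simpa [AddChar.pow_apply, AddChar.map_nsmul_eq_pow, AddChar.inv_apply, AddChar.map_neg_eq_inv] using this
  have h3 : ∑ x, g x ^ 2 ≤ Fintype.card H := by
    have : ∀ x ∈ (univ : Finset H), g x ^ 2 ≤ 1 := fun x _ => (sq_le_one_iff_abs_le_one _).2 (hg x)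
    simpa using sum_le_sum this
  have h4 : (Fintype.card H : ℝ) * |∑ x, ∑ d, g x * g (x + d) * g (x + 2 • d)| ≤
      (Fintype.card H : ℝ) * (M * Fintype.card H) := by
    refine h2.trans ?_
    rw [mul_left_comm]
    gcongr
  exact le_of_mul_le_mul_left h4 hN

noncomputable def grAvg {G : Type*} [AddCommGroup G] [Fintype G] (H : AddSubgroup G) (f : G → ℝ)
    (x : G) : ℝ := (∑ h : H, f (x + h)) / Fintype.card H

section
variable {G : Type*} [AddCommGroup G] [Fintype G] (H : AddSubgroup G) (f : G → ℝ)

lemma gr_shift {M : Type*} [AddCommMonoid M] (F : G → M) (a : G) : ∑ x, F (x + a) = ∑ x, F x :=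
  Equiv.sum_comp (Equiv.addRight a) F

lemma gr_shiftl {M : Type*} [AddCommMonoid M] (F : G → M) (a : G) : ∑ x, F (a + x) = ∑ x, F x :=
  Equiv.sum_comp (Equiv.addLeft a) F

lemma gr_cardpos : (0 : ℝ) < Fintype.card H := by exact_mod_cast Fintype.card_pos

lemma grAvg_inv (x : G) (h : H) : grAvg H f (x + h) = grAvg H f x := by
  unfold grAvg
  congr 1
  rw [← gr_shiftl (fun k : H => f (x + k)) h]
  simp [add_assoc]

lemma grAvg_sum_sub (x : G) : ∑ h : H, (f (x + h) - grAvg H f (x + h)) = 0 := by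
  simp_rw [grAvg_inv]
  have := (gr_cardpos H).ne'
  rw [sum_sub_distrib]
  simp [grAvg]
  field_simp
  simp

lemma gr_sum_avg (F : G → ℝ) : ∑ x, ∑ h : H, F (x + h) = Fintype.card H * ∑ x, F x := by
  rw [sum_comm]
  simp_rw [gr_shift F]
  simp

lemma grAvg_orth (u : G → ℝ) (hu : ∀ x, ∀ h : H, u (x + h) = u x) :
    ∑ x, u x * (f x - grAvg H f x) = 0 := by
  have h := gr_sum_avg H (fun x => u x * (f x - grAvg H f x))
  simp only [hu, ← mul_sum, grAvg_sum_sub] at h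
  have := (gr_cardpos H).ne'
  simp_all

lemma grAvg_sum : ∑ x, grAvg H f x = ∑ x, f x := by
  have := grAvg_orth H f (fun _ => 1) (by simp)
  simp at this
  linarith

lemma grAvg_mem (h0 : ∀ x, 0 ≤ f x) (h1 : ∀ x, f x ≤ 1) (x : G) :
    0 ≤ grAvg H f x ∧ grAvg H f x ≤ 1 := by
  unfold grAvg
  refine ⟨div_nonneg (sum_nonneg fun _ _ => h0 _) (gr_cardpos H).le, ?_⟩
  rw [div_le_one (gr_cardpos H)]
  simpa using sum_le_sum (fun (h : H) (_ : h ∈ univ) => h1 (x + h))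

set_option maxHeartbeats 1000000 in
lemma gr_count (h0 : ∀ x, 0 ≤ f x) (h1 : ∀ x, f x ≤ 1) (p : ℕ) [Fact p.Prime]
    (hp : ∀ x : G, p • x = 0) :
    Fintype.card H * ∑ x, grAvg H f x ^ 3 +
      ∑ x, ∑ d : H, (f x - grAvg H f x) * (f (x + d) - grAvg H f (x + d)) *
        (f (x + 2 • (d : G)) - grAvg H f (x + 2 • (d : G)))
    ≤ ∑ x, ∑ d : H, f x * f (x + d) * f (x + 2 • (d : G)) := by
  set c := grAvg H f with hc
  set g : G → ℝ := fun x => f x - c x with hgd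
  have cinv : ∀ x, ∀ d : H, c (x + d) = c x := grAvg_inv H f
  have cinv2 : ∀ x, ∀ d : H, c (x + 2 • (d : G)) = c x := fun x d => cinv x (2 • d)
  have gs : ∀ x, ∑ d : H, g (x + d) = 0 := grAvg_sum_sub H f
  have orth : ∑ x, c x ^ 2 * g x = 0 := grAvg_orth H f (fun x => c x ^ 2) (by simp [cinv])
  have e : ∀ x, ∀ d : H, f x * f (x + d) * f (x + 2 • (d : G)) =
      c x ^ 3 + c x ^ 2 * g x + c x ^ 2 * g (x + d) + c x ^ 2 * g (x + 2 • (d : G))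
      + c x * g x * g (x + d) + c x * g x * g (x + 2 • (d : G))
      + c x * g (x + d) * g (x + 2 • (d : G)) + g x * g (x + d) * g (x + 2 • (d : G)) := by
    intro x d
    simp only [hgd, cinv, cinv2]
    ring
  have t1 : ∑ x, ∑ d : H, c x ^ 2 * g x = 0 := by
    rw [sum_comm]; exact sum_eq_zero fun _ _ => orth
  have t2 : ∑ x, ∑ d : H, c x ^ 2 * g (x + d) = 0 := by
    simp [← mul_sum, gs]
  have t3 : ∑ x, ∑ d : H, c x ^ 2 * g (x + 2 • (d : G)) = 0 := by
    rw [sum_comm]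
    refine sum_eq_zero fun d _ => ?_
    rw [← orth, ← gr_shift (fun x => c x ^ 2 * g x) (2 • (d : G))]
    simp [cinv2]
  have t4 : ∑ x, ∑ d : H, c x * g x * g (x + d) = 0 := by
    simp [← mul_sum, gs]
  have t6 : ∑ x, ∑ d : H, c x * g (x + d) * g (x + 2 • (d : G)) = 0 := by
    rw [← t4, sum_comm]
    conv_rhs => rw [sum_comm]
    refine sum_congr rfl fun d _ => ?_
    rw [← gr_shift (fun x => c x * g x * g (x + d)) (d : G)]
    simp [cinv, two_nsmul, add_assoc]
  have t5 : 0 ≤ ∑ x, ∑ d : H, c x * g x * g (x + 2 • (d : G)) := by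
    simp_rw [← mul_sum]
    refine sum_nonneg fun x _ => ?_
    rcases (Fact.out : p.Prime).eq_two_or_odd' with h2 | hodd
    · subst h2
      simp only [hp, add_zero, sum_const, nsmul_eq_mul]
      have := (grAvg_mem H f h0 h1 x).1
      have : c x * g x * (((univ : Finset H).card : ℝ) * g x) = c x * (((univ : Finset H).card : ℝ) * (g x) ^ 2) := by ring
      rw [this]
      positivity
    · obtain ⟨m, hm⟩ := hodd
      have b : Function.Bijective (fun d : H => 2 • d) := by
        refine Finite.injective_iff_bijective.1 ?_
        intro a b hab
        have hh : ∀ y : H, y = - (m • (2 • y)) := by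
          intro y
          have : p • y = 0 := by ext; simpa using hp y
          rw [hm, add_smul, mul_comm, mul_smul, one_smul] at this
          exact eq_neg_of_add_eq_zero_right this
        rw [hh a, hh b]
        simp only at hab
        rw [hab]
      have : ∑ d : H, g (x + 2 • (d : G)) = 0 := by
        rw [← gs x, ← Equiv.sum_comp (Equiv.ofBijective _ b) (fun d : H => g (x + d))]
        rfl
      simp [this]
  simp_rw [e, sum_add_distrib]
  have t0 : ∑ x, ∑ d : H, c x ^ 3 = Fintype.card H * ∑ x, c x ^ 3 := by
    rw [sum_comm]; simp
  linarith
end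
lemma gr_ker_index {H : Type*} [AddCommGroup H] [Fintype H] (p : ℕ) [Fact p.Prime]
    (hp : ∀ x : H, p • x = 0) (ψ : AddChar H ℂ) :
    ∃ K : AddSubgroup H, K.index ≤ p ∧ ∀ k ∈ K, ψ k = 1 := by
  have : NeZero p := ⟨(Fact.out : p.Prime).ne_zero⟩
  let φ : H →+ Additive (rootsOfUnity p ℂ) :=
    { toFun := fun h => Additive.ofMul (rootsOfUnity.mkOfPowEq (ψ h)
        (by rw [← AddChar.map_nsmul_eq_pow, hp, AddChar.map_zero_eq_one]))
      map_zero' := by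
        apply Additive.toMul.injective
        ext
        simp
      map_add' := by
        intro a b
        apply Additive.toMul.injective
        ext
        simp [AddChar.map_add_eq_mul] }
  refine ⟨φ.ker, ?_, ?_⟩
  · rw [AddSubgroup.index_ker]
    refine le_trans ?_ (card_rootsOfUnity ℂ p)
    have : Finite (Additive (rootsOfUnity p ℂ)) := inferInstanceAs (Finite (rootsOfUnity p ℂ))
    exact Nat.card_le_card_of_injective (β := Additive (rootsOfUnity p ℂ)) _ Subtype.val_injective
  · intro k hk
    have h : φ k = 0 := hk
    have h2 : (((Additive.toMul (φ k) : rootsOfUnity p ℂ) : ℂˣ) : ℂ) = 1 := by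
      rw [h]; simp
    simpa [φ] using h2

lemma gr_subgroup {G : Type*} [AddCommGroup G] [Fintype G] (H : AddSubgroup G) (p : ℕ)
    [Fact p.Prime] (hp : ∀ x : G, p • x = 0) (ψ : G ⧸ H → AddChar H ℂ) :
    ∃ (H' : AddSubgroup G) (hle : H' ≤ H), H'.index ≤ p ^ H.index * H.index ∧
      ∀ q, ∀ k (hk : k ∈ H'), ψ q ⟨k, hle hk⟩ = 1 := by
  have hp' : ∀ x : H, p • x = 0 := fun x => by ext; simpa using hp x
  choose K hK1 hK2 using fun q => gr_ker_index p hp' (ψ q)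
  refine ⟨(⨅ q, K q).map H.subtype, AddSubgroup.map_subtype_le _, ?_, ?_⟩
  · rw [AddSubgroup.index_map_subtype]
    refine Nat.mul_le_mul_right _ ((AddSubgroup.index_iInf_le _).trans ?_)
    refine (prod_le_prod' fun q _ => hK1 q).trans ?_
    simp [AddSubgroup.index]
  · rintro q k ⟨h, hh, rfl⟩
    exact hK2 q _ ((AddSubgroup.mem_iInf.1 hh) q)

set_option maxHeartbeats 1000000 in
lemma gr_increment {G : Type*} [AddCommGroup G] [Fintype G] (H : AddSubgroup G) (p : ℕ)
    [Fact p.Prime] (hp : ∀ x : G, p • x = 0) (f : G → ℝ) (h0 : ∀ x, 0 ≤ f x) (h1 : ∀ x, f x ≤ 1)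
    (δ : ℝ) (hδ : 0 ≤ δ)
    (hbad : δ * (Fintype.card G * Fintype.card H) ≤
      |∑ x, ∑ d : H, (f x - grAvg H f x) * (f (x + d) - grAvg H f (x + d)) *
        (f (x + 2 • (d : G)) - grAvg H f (x + 2 • (d : G)))|) :
    ∃ H' : AddSubgroup G, H'.index ≤ p ^ H.index * H.index ∧
      ∑ x, grAvg H f x ^ 2 + δ ^ 2 * Fintype.card G ≤ ∑ x, grAvg H' f x ^ 2 := by
  set c := grAvg H f with hc
  set g : G → ℝ := fun x => f x - c x with hgd
  have hg1 : ∀ x, |g x| ≤ 1 := fun x => by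
    have := grAvg_mem H f h0 h1 x
    rw [abs_le]
    constructor <;> simp only [hgd, hc] <;> linarith [h0 x, h1 x]
  have cinv : ∀ x, ∀ d : H, c (x + d) = c x := grAvg_inv H f
  have hN := gr_cardpos H
  -- characters
  have ex : ∀ q : G ⧸ H, ∃ ψ : AddChar H ℂ, ∀ v : G, (QuotientAddGroup.mk v : G ⧸ H) = q →
      |∑ x : H, ∑ d : H, g (v + x) * g (v + x + d) * g (v + x + 2 • (d : G))| ≤
      ‖∑ x : H, (g (v + x) : ℂ) * ψ x‖ * Fintype.card H := by
    intro q
    obtain ⟨w, rfl⟩ := QuotientAddGroup.mk_surjective q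
    obtain ⟨ψ, hψ⟩ := gr_fourier (fun h : H => g (w + h)) (fun h => hg1 _)
    refine ⟨ψ, fun v hv => ?_⟩
    have hm : -w + v ∈ H := QuotientAddGroup.eq.1 hv.symm
    obtain ⟨a, ha⟩ : ∃ a : H, v = w + a := ⟨⟨_, hm⟩, by simp⟩
    subst ha
    have e1 : ∑ x : H, ∑ d : H, g (w + a + x) * g (w + a + x + d) * g (w + a + x + 2 • (d : G))
        = ∑ x : H, ∑ d : H, g (w + x) * g (w + (x + d : H)) * g (w + (x + 2 • d : H)) := by
      rw [← gr_shiftl (fun x : H => ∑ d : H, g (w + x) * g (w + (x + d : H)) *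
        g (w + (x + 2 • d : H))) a]
      simp [add_assoc]
    have e2 : ‖∑ x : H, (g (w + a + x) : ℂ) * ψ x‖ = ‖∑ x : H, (g (w + x) : ℂ) * ψ x‖ := by
      rw [← gr_shiftl (fun x : H => (g (w + x) : ℂ) * ψ x) a]
      have : ∀ x : H, (g (w + (a + x : H)) : ℂ) * ψ (a + x)
          = ψ a * ((g (w + a + x) : ℂ) * ψ x) := by
        intro x
        rw [AddChar.map_add_eq_mul]
        push_cast
        rw [add_assoc]
        ring
      simp_rw [this]
      rw [← mul_sum, norm_mul, AddChar.norm_apply, one_mul]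
    rw [e1, e2]
    exact hψ
  choose ψ hψ using ex
  obtain ⟨H', hle, hidx, hker⟩ := gr_subgroup H p hp ψ
  refine ⟨H', hidx, ?_⟩
  have hN' := gr_cardpos H'
  set c' := grAvg H' f with hc'
  have cinv' : ∀ x, ∀ d : H', c (x + d) = c x := fun x d => cinv x ⟨d, hle d.2⟩
  set g' : G → ℝ := fun x => c' x - c x with hg'd
  have hg' : ∀ x, (Fintype.card H' : ℝ) * g' x = ∑ k : H', g (x + k) := by
    intro x
    simp only [hgd, cinv', sum_sub_distrib, hg'd, hc', grAvg]
    simp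
    field_simp
  have hM : ∀ v : G, ‖∑ x : H, (g (v + x) : ℂ) * ψ (QuotientAddGroup.mk v) x‖ ≤
      ∑ x : H, |g' (v + x)| := by
    intro v
    set χ := ψ (QuotientAddGroup.mk v)
    have : (Fintype.card H' : ℂ) * ∑ x : H, (g (v + x) : ℂ) * χ x =
        (Fintype.card H' : ℂ) * ∑ x : H, (g' (v + x) : ℂ) * χ x := by
      have a1 : ∀ x : H, (Fintype.card H' : ℂ) * ((g' (v + x) : ℂ) * χ x) =
          ∑ k : H', (g (v + x + k) : ℂ) * χ x := by
        intro x
        rw [← sum_mul, ← mul_assoc]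
        congr 1
        exact_mod_cast hg' (v + x)
      conv_rhs => rw [mul_sum]
      simp_rw [a1]
      rw [sum_comm]
      have a2 : ∀ k : H', ∑ x : H, (g (v + x + k) : ℂ) * χ x = ∑ x : H, (g (v + x) : ℂ) * χ x := by
        intro k
        rw [← gr_shift (fun x : H => (g (v + x) : ℂ) * χ x) ⟨k, hle k.2⟩]
        refine sum_congr rfl fun x _ => ?_
        rw [AddChar.map_add_eq_mul, hker _ _ k.2, mul_one]
        simp [add_assoc]
      simp_rw [a2]
      simp
    have hne : (Fintype.card H' : ℂ) ≠ 0 := by exact_mod_cast hN'.ne'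
    rw [mul_left_cancel₀ hne this]
    refine (norm_sum_le _ _).trans (sum_le_sum fun x _ => ?_)
    rw [norm_mul, AddChar.norm_apply, mul_one, Complex.norm_real, Real.norm_eq_abs]
  have hsum : δ * Fintype.card G ≤ ∑ x, |g' x| := by
    have s1 := gr_sum_avg H (fun x => ∑ d : H, g x * g (x + d) * g (x + 2 • (d : G)))
    have s2 : |∑ x, ∑ h : H, ∑ d : H, g (x + h) * g (x + h + d) * g (x + h + 2 • (d : G))| ≤
        (Fintype.card H * ∑ x, |g' x|) * Fintype.card H := by
      rw [← gr_sum_avg H (fun x => |g' x|), sum_mul]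
      refine (abs_sum_le_sum_abs _ _).trans (sum_le_sum fun v _ => ?_)
      refine (hψ _ v rfl).trans ?_
      exact mul_le_mul_of_nonneg_right (hM v) hN.le
    rw [s1, abs_mul, abs_of_pos hN] at s2
    have s3 := mul_le_mul_of_nonneg_left hbad hN.le
    have s4 : (Fintype.card H * Fintype.card H : ℝ) * (δ * Fintype.card G) ≤
        (Fintype.card H * Fintype.card H : ℝ) * ∑ x, |g' x| := by
      have := s3.trans s2
      linarith
    exact le_of_mul_le_mul_left s4 (by positivity)
  have hcs : δ ^ 2 * Fintype.card G ≤ ∑ x, g' x ^ 2 := by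
    have hG : (0 : ℝ) < Fintype.card G := by exact_mod_cast Fintype.card_pos
    have := sq_sum_le_card_mul_sum_sq (s := (univ : Finset G)) (f := fun x => |g' x|)
    simp only [sq_abs, card_univ] at this
    have h2 := pow_le_pow_left₀ (by positivity) hsum 2
    have h3 : (Fintype.card G : ℝ) * (δ ^ 2 * Fintype.card G) ≤
      (Fintype.card G : ℝ) * ∑ x, g' x ^ 2 := by nlinarith
    exact le_of_mul_le_mul_left h3 hG
  have o1 := grAvg_orth H f c cinv
  have o2 := grAvg_orth H' f c cinv'
  have o3 : ∑ x, c x * g' x = 0 := by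
    have : ∀ x, c x * g' x = c x * (f x - grAvg H f x) - c x * (f x - grAvg H' f x) := by
      intro x; simp only [hg'd, hc, hc']; ring
    simp_rw [this, sum_sub_distrib]
    rw [o1, o2, sub_zero]
  have o4 : ∑ x, c' x ^ 2 = ∑ x, c x ^ 2 + 2 * ∑ x, c x * g' x + ∑ x, g' x ^ 2 := by
    rw [mul_sum, ← sum_add_distrib, ← sum_add_distrib]
    refine sum_congr rfl fun x _ => ?_
    simp only [hg'd]; ring
  rw [o4, o3]
  linarith

def grN (p : ℕ) : ℕ → ℕ
  | 0 => 1
  | k + 1 => p ^ grN p k * grN p k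

lemma gr_iter (p : ℕ) [Fact p.Prime] (δ : ℝ) (hδ : 0 < δ) : ∃ K : ℕ, ∀ (n : ℕ)
    (f : (Fin n → ZMod p) → ℝ) (_ : ∀ x, 0 ≤ f x) (_ : ∀ x, f x ≤ 1),
    ∃ H : AddSubgroup (Fin n → ZMod p), H.index ≤ K ∧
      |∑ x, ∑ d : H, (f x - grAvg H f x) * (f (x + d) - grAvg H f (x + d)) *
        (f (x + 2 • (d : Fin n → ZMod p)) - grAvg H f (x + 2 • (d : Fin n → ZMod p)))|
        ≤ δ * (Fintype.card (Fin n → ZMod p) * Fintype.card H) := by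
  have hpp : 0 < p := (Fact.out : p.Prime).pos
  obtain ⟨m, hm⟩ := exists_nat_gt (1 / δ ^ 2)
  have hmono : Monotone (grN p) := monotone_nat_of_le_succ fun k => by
    exact Nat.le_mul_of_pos_left _ (by positivity)
  refine ⟨grN p m, fun n f h0 h1 => ?_⟩
  have hp : ∀ x : Fin n → ZMod p, p • x = 0 := fun x => by ext; simp
  by_contra hcon
  push Not at hcon
  have hG : (0 : ℝ) < Fintype.card (Fin n → ZMod p) := by exact_mod_cast Fintype.card_pos
  have step : ∀ k ≤ m, ∃ H : AddSubgroup (Fin n → ZMod p), H.index ≤ grN p k ∧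
      k * (δ ^ 2 * Fintype.card (Fin n → ZMod p)) ≤ ∑ x, grAvg H f x ^ 2 := by
    intro k
    induction k with
    | zero =>
      intro _
      refine ⟨⊤, by simp [grN], ?_⟩
      simp only [Nat.cast_zero, zero_mul]
      positivity
    | succ k ih =>
      intro hk
      obtain ⟨H, hi, he⟩ := ih (by omega)
      obtain ⟨H', hi', he'⟩ := gr_increment H p hp f h0 h1 δ hδ.le
        (hcon H (hi.trans (hmono (by omega)))).le
      refine ⟨H', hi'.trans ?_, ?_⟩
      · exact Nat.mul_le_mul (Nat.pow_le_pow_right hpp hi) hi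
      · push_cast
        linarith
  obtain ⟨H, -, he⟩ := step m le_rfl
  have hle : ∑ x, grAvg H f x ^ 2 ≤ Fintype.card (Fin n → ZMod p) := by
    have : ∀ x ∈ (univ : Finset (Fin n → ZMod p)), grAvg H f x ^ 2 ≤ 1 := fun x _ =>
      pow_le_one₀ (grAvg_mem H f h0 h1 x).1 (grAvg_mem H f h0 h1 x).2
    simpa using sum_le_sum this
  rw [div_lt_iff₀ (by positivity)] at hm
  nlinarith

set_option maxHeartbeats 1000000 in
lemma gr_main (ε : ℝ) (hε : 0 < ε) (p : ℕ) [Fact p.Prime] :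
    ∃ n₀ : ℕ, 0 < n₀ ∧ ∀ n : ℕ, n₀ ≤ n → ∀ A : Finset (Fin n → ZMod p),
      ∃ d : Fin n → ZMod p, d ≠ 0 ∧
        (((Finset.univ.filter fun x : Fin n → ZMod p =>
              x ∈ A ∧ x + d ∈ A ∧ x + 2 • d ∈ A).card : ℝ) / (p : ℝ) ^ n ≥
          ((A.card : ℝ) / (p : ℝ) ^ n) ^ 3 - ε) := by
  obtain ⟨K, hK⟩ := gr_iter p (ε / 2) (by positivity)
  obtain ⟨m, hm⟩ := exists_nat_gt (K * (2 / ε))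
  have hp2 : 2 ≤ p := (Fact.out : p.Prime).two_le
  refine ⟨m + 1, by omega, fun n hn A => ?_⟩
  set P : ℝ := (p : ℝ) ^ n with hP
  have hP0 : 0 < P := by positivity
  have hcard : (Fintype.card (Fin n → ZMod p) : ℝ) = P := by
    simp [hP, ZMod.card]
  set α := (A.card : ℝ) / P with hα
  by_contra hcon
  push Not at hcon
  set f : (Fin n → ZMod p) → ℝ := fun x => if x ∈ A then 1 else 0 with hf
  have h0 : ∀ x, 0 ≤ f x := fun x => by simp only [hf]; split_ifs <;> norm_num
  have h1 : ∀ x, f x ≤ 1 := fun x => by simp only [hf]; split_ifs <;> norm_num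
  obtain ⟨H, hi, hH⟩ := hK n f h0 h1
  have hN := gr_cardpos H
  have hp : ∀ x : Fin n → ZMod p, p • x = 0 := fun x => by ext; simp
  have hcnt := gr_count H f h0 h1 p hp
  rw [hcard] at hH
  have hsumf : ∑ x, f x = A.card := by simp [hf]
  have hjen : P * α ^ 3 ≤ ∑ x, grAvg H f x ^ 3 := by
    have := pow_sum_div_card_le_sum_pow (s := univ) (f := grAvg H f)
      (fun x _ => (grAvg_mem H f h0 h1 x).1) 2
    rw [grAvg_sum, hsumf, card_univ, hcard] at this
    refine le_trans (le_of_eq ?_) this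
    rw [hα]; field_simp
  have hT : ∀ d : Fin n → ZMod p, ∑ x, f x * f (x + d) * f (x + 2 • d) =
      ((univ.filter fun x : Fin n → ZMod p => x ∈ A ∧ x + d ∈ A ∧ x + 2 • d ∈ A).card : ℝ) := by
    intro d
    rw [card_filter]
    push_cast
    refine sum_congr rfl fun x _ => ?_
    simp only [hf]
    by_cases a1 : x ∈ A <;> by_cases a2 : x + d ∈ A <;> by_cases a3 : x + 2 • d ∈ A <;>
      simp only [a1, a2, a3, if_true, if_false, mul_one, mul_zero, and_true, and_false]
  -- lower bound
  have hlow : Fintype.card H * (P * α ^ 3) - ε / 2 * (P * Fintype.card H) ≤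
      ∑ d : H, ∑ x, f x * f (x + d) * f (x + 2 • (d : Fin n → ZMod p)) := by
    rw [sum_comm]
    have := neg_le_of_abs_le hH
    have := mul_le_mul_of_nonneg_left hjen hN.le
    linarith
  have hne : ∃ d : Fin n → ZMod p, d ≠ 0 :=
    ⟨fun _ => 1, fun h => one_ne_zero (congrFun h ⟨0, by omega⟩)⟩
  have hpos : 0 ≤ α ^ 3 - ε := by
    obtain ⟨d, hd⟩ := hne
    refine le_trans ?_ (hcon d hd).le
    positivity
  have hup : ∑ d : H, ∑ x, f x * f (x + d) * f (x + 2 • (d : Fin n → ZMod p)) ≤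
      ∑ d : H, (P * (α ^ 3 - ε) + if d = 0 then P else 0) := by
    refine sum_le_sum fun d _ => ?_
    rw [hT]
    split_ifs with hd
    · have : ((univ.filter fun x : Fin n → ZMod p =>
          x ∈ A ∧ x + (d : Fin n → ZMod p) ∈ A ∧ x + 2 • (d : Fin n → ZMod p) ∈ A).card : ℝ) ≤ P := by
        rw [← hcard]
        exact_mod_cast card_le_univ _
      have := mul_nonneg hP0.le hpos
      linarith
    · have := hcon d (by simpa using hd)
      rw [div_lt_iff₀ hP0] at this
      linarith
  have hup2 : ∑ d : H, (P * (α ^ 3 - ε) + if d = 0 then P else 0) =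
      Fintype.card H * (P * (α ^ 3 - ε)) + P := by
    rw [sum_add_distrib]; simp
  have hfin : (Fintype.card H : ℝ) * (ε / 2) ≤ 1 := by
    have : P * ((Fintype.card H : ℝ) * (ε / 2)) ≤ P * 1 := by linarith
    exact le_of_mul_le_mul_left this hP0
  have hidx : (Fintype.card H : ℝ) * H.index = P := by
    rw [← hcard]
    have := H.card_mul_index
    rw [Nat.card_eq_fintype_card, Nat.card_eq_fintype_card] at this
    exact_mod_cast this
  have hPm : (m : ℝ) < P := by
    have h1 : n < p ^ n := Nat.lt_pow_self (by omega)
    have : m < p ^ n := by omega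
    rw [hP]
    exact_mod_cast this
  have hiK : (H.index : ℝ) ≤ K := by exact_mod_cast hi
  have hHle : (Fintype.card H : ℝ) ≤ 2 / ε := by
    rw [le_div_iff₀ hε]; linarith
  have : P ≤ K * (2 / ε) := by
    rw [← hidx, mul_comm]
    exact mul_le_mul hiK hHle hN.le (by positivity)
  linarith

end GreenAux

/-- Green's theorem on popular common differences.
For each `ε > 0` and each prime `p` there is a positive integer `n₀` such that for every
`n ≥ n₀` and every subset `A` of `𝔽_p^n` with density `α = |A| / p^n`, there is a nonzero
`d ∈ 𝔽_p^n` such that the density of three-term arithmetic progressions with common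
difference `d` contained in `A` is at least `α³ - ε`. -/
theorem green_popular_difference (ε : ℝ) (hε : 0 < ε) (p : ℕ) [Fact p.Prime] :
    ∃ n₀ : ℕ, 0 < n₀ ∧ ∀ n : ℕ, n₀ ≤ n → ∀ A : Finset (Fin n → ZMod p),
      ∃ d : Fin n → ZMod p, d ≠ 0 ∧
        (((Finset.univ.filter fun x : Fin n → ZMod p =>
              x ∈ A ∧ x + d ∈ A ∧ x + 2 • d ∈ A).card : ℝ) / (p : ℝ) ^ n ≥
          ((A.card : ℝ) / (p : ℝ) ^ n) ^ 3 - ε) := by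
  convert gr_main ε hε p
end

section
/- Mean cube density increment: Let p be an odd prime, ε > 0, f : 𝔽_p^n → [0,1] a function of density α, and H a subspace of 𝔽_p^n with |H| > 4α/ε (and with n large enough that the codimension bound below is at most n). Suppose the density of 3-APs with nonzero common difference of f averaged over the cosets of H, namely 𝔼_{g}[λ(H+g)] where λ(H+g) = 𝔼_{x,y,z ∈ H+g distinct, x−2y+z=0}[f(x)f(y)f(z)], is less than α³ − ε. Then there is a subspace H' ⊆ H with codim(H') ≤ codim(H) + p^{codim(H)}·144/ε² such that b(H') − α³ > 2(b(H) − α³) + ε/2, where b(K) = 𝔼_{g ∈ 𝔽_p^n}[(𝔼_{y ∈ K+g} f(y))³] is the mean cube density of f with respect to the subspace K. -/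
/-- The density `α(K + g) = 𝔼_{y ∈ K + g}[f(y)]` of `f` on the coset `K + g`. -/
noncomputable def avgCoset {p n : ℕ} [NeZero p] (K : Submodule (ZMod p) (Fin n → ZMod p))
    (f : (Fin n → ZMod p) → ℝ) (g : Fin n → ZMod p) : ℝ :=
  haveI := Fintype.ofFinite K
  (∑ y : K, f (g + y)) / (Nat.card K : ℝ)

/-- The mean cube density `b(K) = 𝔼_{g ∈ 𝔽_p^n}[α(K + g)³]` of `f` with respect to
the subspace `K`. -/
noncomputable def meanCube {p n : ℕ} [NeZero p] (K : Submodule (ZMod p) (Fin n → ZMod p))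
    (f : (Fin n → ZMod p) → ℝ) : ℝ :=
  (∑ g : Fin n → ZMod p, avgCoset K f g ^ 3) / (p : ℝ) ^ n

open scoped Classical in
/-- The density `λ(H + g)` of nontrivial 3-APs of `f` in the affine subspace `H + g`:
the sum of `f(x) f(y) f(z)` over triples of distinct `x, y, z ∈ H + g` with
`x - 2y + z = 0`, divided by the number `|H| (|H| - 1)` of such triples. -/
noncomputable def lamCoset {p n : ℕ} [NeZero p] (H : Submodule (ZMod p) (Fin n → ZMod p))
    (f : (Fin n → ZMod p) → ℝ) (g : Fin n → ZMod p) : ℝ :=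
  (∑ t ∈ (Finset.univ :
        Finset ((Fin n → ZMod p) × (Fin n → ZMod p) × (Fin n → ZMod p))).filter
      (fun t => t.1 - g ∈ H ∧ t.2.1 - g ∈ H ∧ t.2.2 - g ∈ H ∧
        t.1 ≠ t.2.1 ∧ t.2.1 ≠ t.2.2 ∧ t.1 ≠ t.2.2 ∧ t.1 - 2 • t.2.1 + t.2.2 = 0),
      f t.1 * f t.2.1 * f t.2.2) /
    ((Nat.card H : ℝ) * ((Nat.card H : ℝ) - 1))

set_option linter.unusedSectionVars false

noncomputable section
variable {p : ℕ} [Fact p.Prime] {V : Type*} [AddCommGroup V] [Module (ZMod p) V] [Fintype V]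

def chi (φ : Module.Dual (ZMod p) V) (v : V) : ℂ := ZMod.stdAddChar (φ v)

def hatF (F : V → ℝ) (φ : Module.Dual (ZMod p) V) : ℂ :=
  (∑ v, (F v : ℂ) * chi φ v) / (Fintype.card V : ℂ)

def Lam (F : V → ℝ) : ℝ := (∑ x, ∑ y, F x * F y * F (y + y - x)) / (Fintype.card V : ℝ) ^ 2

def avgW (W : Submodule (ZMod p) V) [Fintype W] (F : V → ℝ) (v : V) : ℝ :=
  (∑ w : W, F (v + w)) / (Fintype.card W : ℝ)

lemma chi_add (φ : Module.Dual (ZMod p) V) (v w : V) : chi φ (v + w) = chi φ v * chi φ w := by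
  simp [chi, AddChar.map_add_eq_mul]

lemma chi_norm (φ : Module.Dual (ZMod p) V) (v : V) : ‖chi φ v‖ = 1 := by
  simp [chi]

lemma chi_neg (φ : Module.Dual (ZMod p) V) (v : V) :
    chi φ (-v) = (starRingEnd ℂ) (chi φ v) := by
  simp [chi, AddChar.map_neg_eq_conj]

lemma chi_two (φ : Module.Dual (ZMod p) V) (v : V) : chi (-(φ + φ)) v = chi φ (-(v+v)) := by
  simp [chi]

lemma finDual : Finite (Module.Dual (ZMod p) V) := DFunLike.finite _

lemma card_dual [Fintype (Module.Dual (ZMod p) V)] :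
    Fintype.card (Module.Dual (ZMod p) V) = Fintype.card V := by
  have : Module.Finite (ZMod p) V := Module.Finite.of_finite
  rw [Module.card_eq_pow_finrank (K := ZMod p) (V := V),
    Module.card_eq_pow_finrank (K := ZMod p) (V := Module.Dual (ZMod p) V), Subspace.dual_finrank_eq]

lemma sum_chi_dual [Fintype (Module.Dual (ZMod p) V)] [DecidableEq V] (v : V) :
    ∑ φ : Module.Dual (ZMod p) V, chi φ v = if v = 0 then (Fintype.card V : ℂ) else 0 := by
  classical
  let Ψ : AddChar (Module.Dual (ZMod p) V) ℂ :=
    (ZMod.stdAddChar (N := p)).compAddMonoidHom (LinearMap.applyₗ (R := ZMod p) v).toAddMonoidHom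
  have h := AddChar.sum_eq_ite Ψ
  have h2 : Ψ = 0 ↔ v = 0 := by
    constructor
    · intro h0
      rw [← Module.forall_dual_apply_eq_zero_iff (ZMod p)]
      intro φ
      apply ZMod.injective_stdAddChar (N := p)
      have := DFunLike.congr_fun h0 φ
      simpa [Ψ] using this
    · rintro rfl
      ext φ
      simp [Ψ]
  rw [card_dual] at h
  simp only [h2] at h
  rw [← h]
  rfl

lemma sum_chi_sub (W : Submodule (ZMod p) V) [Fintype W] (φ : Module.Dual (ZMod p) V)
    [Decidable (W ≤ LinearMap.ker φ)] :
    ∑ w : W, chi φ w = if W ≤ LinearMap.ker φ then (Fintype.card W : ℂ) else 0 := by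
  classical
  let Ψ : AddChar W ℂ :=
    (ZMod.stdAddChar (N := p)).compAddMonoidHom (φ.comp W.subtype).toAddMonoidHom
  have h := AddChar.sum_eq_ite Ψ
  have h2 : Ψ = 0 ↔ W ≤ LinearMap.ker φ := by
    constructor
    · intro h0 w hw
      apply ZMod.injective_stdAddChar (N := p)
      have := DFunLike.congr_fun h0 ⟨w, hw⟩
      simpa [Ψ] using this
    · intro h
      ext w
      have := h w.2
      simp only [LinearMap.mem_ker] at this
      simp [Ψ, this]
  simp only [h2] at h
  rw [← h]
  rfl

lemma hat_shift (F : V → ℝ) (φ : Module.Dual (ZMod p) V) (w : V) :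
    hatF (fun v => F (v + w)) φ = hatF F φ * chi φ (-w) := by
  unfold hatF
  rw [div_mul_eq_mul_div]
  congr 1
  rw [Finset.sum_mul, ← Equiv.sum_comp (Equiv.addRight w) (fun v => (F v : ℂ) * chi φ v * chi φ (-w))]
  refine Finset.sum_congr rfl fun v _ => ?_
  simp only [Equiv.coe_addRight]
  rw [mul_assoc, ← chi_add]
  simp

lemma hat_avg (W : Submodule (ZMod p) V) [Fintype W] (F : V → ℝ) (φ : Module.Dual (ZMod p) V)
    [Decidable (W ≤ LinearMap.ker φ)] :
    hatF (avgW W F) φ = if W ≤ LinearMap.ker φ then hatF F φ else 0 := by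
  have h1 : hatF (avgW W F) φ = (∑ w : W, hatF (fun v => F (v + w)) φ) / (Fintype.card W : ℂ) := by
    unfold hatF avgW
    rw [← Finset.sum_div, Finset.sum_comm, div_right_comm, Finset.sum_div (s := Finset.univ (α := V))
      (a := (Fintype.card W : ℂ))]
    congr 1
    refine Finset.sum_congr rfl fun v _ => ?_
    rw [← Finset.sum_mul]
    push_cast
    ring
  rw [h1]
  simp only [hat_shift]
  rw [← Finset.mul_sum]
  have h2 : ∑ w : W, chi φ (-(w : V)) = ∑ w : W, chi φ (w : V) := by
    rw [← Equiv.sum_comp (Equiv.neg W)]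
    simp
  rw [h2, sum_chi_sub]
  have : (Fintype.card W : ℂ) ≠ 0 := by simp
  split_ifs
  · field_simp
  · simp

lemma parseval [Fintype (Module.Dual (ZMod p) V)] (F : V → ℝ) :
    ∑ φ : Module.Dual (ZMod p) V, ‖hatF F φ‖ ^ 2 = (∑ v, F v ^ 2) / (Fintype.card V : ℝ) := by
  classical
  have hV : (Fintype.card V : ℂ) ≠ 0 := by simp
  apply Complex.ofReal_injective
  push_cast
  have h1 : ∀ φ : Module.Dual (ZMod p) V, (‖hatF F φ‖ : ℂ) ^ 2 =
      (∑ v, ∑ w, (F v : ℂ) * F w * chi φ (v - w)) / (Fintype.card V : ℂ) ^ 2 := by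
    intro φ
    rw [← Complex.mul_conj']
    unfold hatF
    simp only [map_div₀, map_sum, map_mul, Complex.conj_ofReal, Complex.conj_natCast, ← chi_neg]
    rw [div_mul_div_comm, Finset.sum_mul_sum, ← sq]
    congr 1
    refine Finset.sum_congr rfl fun v _ => Finset.sum_congr rfl fun w _ => ?_
    rw [sub_eq_add_neg, chi_add]; ring
  simp only [h1]
  rw [← Finset.sum_div, Finset.sum_comm]
  have h2 : ∀ v : V, ∑ φ : Module.Dual (ZMod p) V, ∑ w, (F v : ℂ) * F w * chi φ (v - w)
      = (F v : ℂ) ^ 2 * Fintype.card V := by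
    intro v
    rw [Finset.sum_comm]
    simp only [← Finset.mul_sum, sum_chi_dual, sub_eq_zero, mul_ite, mul_zero]
    simp
    ring
  simp only [h2]
  rw [← Finset.sum_mul]
  field_simp

lemma lam_hat [Fintype (Module.Dual (ZMod p) V)] (F : V → ℝ) :
    (Lam F : ℂ) = ∑ φ : Module.Dual (ZMod p) V, hatF F φ ^ 2 * hatF F (-(φ + φ)) := by
  classical
  have hV : (Fintype.card V : ℂ) ≠ 0 := by simp
  have h1 : ∀ φ : Module.Dual (ZMod p) V, hatF F φ ^ 2 * hatF F (-(φ + φ)) =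
      (∑ x, ∑ y, ∑ z, (F x : ℂ) * F y * F z * chi φ (z - (y + y - x))) /
        (Fintype.card V : ℂ) ^ 3 := by
    intro φ
    unfold hatF
    rw [div_pow, div_mul_div_comm, ← pow_succ, sq, mul_assoc, Finset.sum_mul]
    congr 1
    refine Finset.sum_congr rfl fun x _ => ?_
    rw [mul_comm (∑ v, _) (∑ v, _), Finset.sum_mul, Finset.mul_sum]
    refine Finset.sum_congr rfl fun y _ => ?_
    rw [Finset.mul_sum, Finset.mul_sum]
    refine Finset.sum_congr rfl fun z _ => ?_
    rw [chi_two, show z - (y + y - x) = x + -(y + y) + z by abel, chi_add, chi_add]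
    ring
  simp only [h1]
  rw [← Finset.sum_div, Finset.sum_comm]
  have h2 : ∀ x : V, ∑ φ : Module.Dual (ZMod p) V, ∑ y, ∑ z, (F x : ℂ) * F y * F z *
      chi φ (z - (y + y - x)) = (∑ y, (F x : ℂ) * F y * F (y + y - x)) * Fintype.card V := by
    intro x
    rw [Finset.sum_comm, Finset.sum_mul]
    refine Finset.sum_congr rfl fun y _ => ?_
    rw [Finset.sum_comm]
    simp only [← Finset.mul_sum, sum_chi_dual, sub_eq_zero, mul_ite, mul_zero]
    simp
  simp only [h2]
  rw [← Finset.sum_mul]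
  unfold Lam
  push_cast
  field_simp

lemma lam_diff [Fintype (Module.Dual (ZMod p) V)] (hodd : Odd p) (F : V → ℝ)
    (W : Submodule (ZMod p) V) [Fintype W] (δ : ℝ) (hδ : 0 ≤ δ) (hF : ∀ v, F v ∈ Set.Icc (0:ℝ) 1)
    (hS : ∀ φ : Module.Dual (ZMod p) V, ¬ W ≤ LinearMap.ker φ → ‖hatF F φ‖ ≤ δ) :
    Lam (avgW W F) ≤ Lam F + δ := by
  classical
  have h2 : (2 : ZMod p) ≠ 0 := by
    intro h
    have : ((2 : ℕ) : ZMod p) = 0 := by exact_mod_cast h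
    rw [ZMod.natCast_eq_zero_iff] at this
    have hp := (Nat.prime_dvd_prime_iff_eq (Fact.out : p.Prime) Nat.prime_two).1 this
    subst hp
    exact absurd hodd (by decide)
  have hk : ∀ φ : Module.Dual (ZMod p) V, W ≤ LinearMap.ker (-(φ + φ)) ↔ W ≤ LinearMap.ker φ := by
    intro φ
    have : ∀ a : ZMod p, a + a = 0 ↔ a = 0 := by
      intro a
      rw [← two_mul]
      simp [h2]
    simp only [SetLike.le_def, LinearMap.mem_ker, LinearMap.neg_apply, neg_eq_zero,
      LinearMap.add_apply, this]
  have e : ((Lam (avgW W F) - Lam F : ℝ) : ℂ) = - ∑ φ : Module.Dual (ZMod p) V,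
      if W ≤ LinearMap.ker φ then 0 else hatF F φ ^ 2 * hatF F (-(φ + φ)) := by
    push_cast
    rw [lam_hat (p := p) (avgW W F), lam_hat (p := p) F, ← Finset.sum_sub_distrib, ← Finset.sum_neg_distrib]
    refine Finset.sum_congr rfl fun φ _ => ?_
    rw [hat_avg, hat_avg]
    simp only [hk]
    split_ifs <;> simp
  have hn : ‖((Lam (avgW W F) - Lam F : ℝ) : ℂ)‖ ≤ δ := by
    rw [e, norm_neg]
    refine (norm_sum_le _ _).trans ?_
    have : ∀ φ : Module.Dual (ZMod p) V, ‖(if W ≤ LinearMap.ker φ then (0:ℂ) else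
        hatF F φ ^ 2 * hatF F (-(φ + φ)))‖ ≤ ‖hatF F φ‖ ^ 2 * δ := by
      intro φ
      split_ifs with h
      · simp; positivity
      · rw [norm_mul, norm_pow]
        gcongr
        exact hS _ (by rwa [hk])
    refine (Finset.sum_le_sum fun φ _ => this φ).trans ?_
    rw [← Finset.sum_mul, parseval (p := p)]
    have h1 : (∑ v, F v ^ 2) / (Fintype.card V : ℝ) ≤ 1 := by
      apply div_le_one_of_le₀ _ (by positivity)
      calc ∑ v, F v ^ 2 ≤ ∑ v : V, (1:ℝ) := Finset.sum_le_sum fun v _ => by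
            have := hF v
            exact pow_le_one₀ this.1 this.2
        _ = _ := by simp
    nlinarith
  rw [Complex.norm_real] at hn
  have := (abs_le.1 hn).2
  linarith

lemma schur3 (a b c : ℝ) (ha : 0 ≤ a) (hb : 0 ≤ b) (hc : 0 ≤ c) :
    a^2*b + a^2*c + b^2*a + b^2*c + c^2*a + c^2*b ≤ a^3+b^3+c^3+3*(a*b*c) := by
  rcases le_total a b with h1 | h1 <;> rcases le_total b c with h2 | h2 <;>
    rcases le_total a c with h3 | h3 <;>
    nlinarith [mul_nonneg (sub_nonneg.2 h1) (sub_nonneg.2 h2), mul_nonneg (sub_nonneg.2 h1) (sub_nonneg.2 h3), mul_nonneg (sub_nonneg.2 h2) (sub_nonneg.2 h3), mul_nonneg ha (sq_nonneg (a-b)), mul_nonneg hb (sq_nonneg (a-b)), mul_nonneg hc (sq_nonneg (a-b)), mul_nonneg ha (sq_nonneg (a-c)), mul_nonneg hb (sq_nonneg (b-c)), mul_nonneg hc (sq_nonneg (b-c)), mul_nonneg ha (sq_nonneg (b-c)),mul_nonneg hb (sq_nonneg (a-c)), mul_nonneg hc (sq_nonneg (a-c)), mul_nonneg ha (mul_nonneg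 (sub_nonneg.2 h1) (sub_nonneg.2 h3)), mul_nonneg hb (mul_nonneg (sub_nonneg.2 h1) (sub_nonneg.2 h2)), mul_nonneg hc (mul_nonneg (sub_nonneg.2 h2) (sub_nonneg.2 h3))]

lemma schur_avg (hodd : Odd p) (hm : ∀ v : V, (p : ℕ) • v = 0) (F : V → ℝ) (hF : ∀ v, 0 ≤ F v) :
    2 * ((∑ v, F v) / (Fintype.card V : ℝ)) ^ 3 ≤
      (∑ v, F v ^ 3) / (Fintype.card V : ℝ) + Lam F := by
  have hV : (0 : ℝ) < Fintype.card V := by simp [Fintype.card_pos]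
  obtain ⟨k, hk⟩ := hodd
  have hk2 : ∀ v : V, (k+1) • v + (k+1) • v = v := by
    intro v
    rw [← add_nsmul, show k + 1 + (k+1) = p + 1 by omega, add_nsmul, hm]; simp
  -- bijections
  let e2 : V ≃ V := ⟨fun y => y + y, fun y => (k+1) • y, fun y => by
      simp only [smul_add]; exact hk2 y, fun y => hk2 y⟩
  have r1 : ∀ (A B : V → ℝ), ∑ x, ∑ y, A x * B y = (∑ x, A x) * ∑ y, B y := fun A B => by
    rw [Finset.sum_mul_sum]
  have r2 : ∀ (A B : V → ℝ), ∑ x, ∑ y, A y * B (y + y - x) = (∑ x, A x) * ∑ y, B y := fun A B => by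
    rw [Finset.sum_comm, Finset.sum_mul]
    refine Finset.sum_congr rfl fun y _ => ?_
    rw [← Finset.mul_sum, ← Equiv.sum_comp (Equiv.subLeft (y + y)) B]
    simp
  have r3 : ∀ (A B : V → ℝ), ∑ x, ∑ y, A x * B (y + y - x) = (∑ x, A x) * ∑ y, B y := fun A B => by
    rw [Finset.sum_mul]
    refine Finset.sum_congr rfl fun x _ => ?_
    rw [← Finset.mul_sum, ← Equiv.sum_comp (e2.trans (Equiv.subRight x)) B]
    simp [e2]
  have key : ∑ x, ∑ y, (F x^2*F y + F x^2*F (y+y-x) + F y^2*F x + F y^2*F (y+y-x)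
      + F (y+y-x)^2*F x + F (y+y-x)^2*F y) ≤
      ∑ x, ∑ y, (F x^3 + F y ^3 + F (y+y-x)^3 + 3 * (F x * F y * F (y+y-x))) :=
    Finset.sum_le_sum fun x _ => Finset.sum_le_sum fun y _ => schur3 _ _ _ (hF _) (hF _) (hF _)
  simp only [Finset.sum_add_distrib, ← Finset.mul_sum (a := (3:ℝ))] at key
  have s1 := r1 (fun x => F x ^2) F
  have s2 := r3 (fun x => F x ^2) F
  have s3 := r1 F (fun x => F x ^2)
  have s4 := r2 (fun x => F x ^2) F
  have s5 := r3 F (fun x => F x ^2)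
  have s6 := r2 F (fun x => F x ^2)
  have t1 := r1 (fun x => F x ^3) (fun _ => 1)
  have t2 := r1 (fun _ => 1) (fun x => F x ^3)
  have t3 := r3 (fun _ => 1) (fun x => F x ^3)
  simp only [mul_one, one_mul, Finset.sum_const, Finset.card_univ, nsmul_eq_mul] at *
  have s3' : ∑ x, ∑ y, F y^2 * F x = (∑ x, F x) * ∑ x, F x^2 := by simpa only [mul_comm] using s3
  have s5' : ∑ x, ∑ y, F (y+y-x)^2 * F x = (∑ x, F x) * ∑ x, F x^2 := by
    rw [← s5]; simp only [mul_comm]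
  have s6' : ∑ x, ∑ y, F (y+y-x)^2 * F y = (∑ x, F x) * ∑ x, F x^2 := by
    rw [← s6]; simp only [mul_comm]
  have t1' : ∑ x, (Fintype.card V : ℝ) * F x ^ 3 = Fintype.card V * ∑ x, F x ^ 3 := by
    rw [Finset.mul_sum]
  rw [s1, s2, s3', s4, s5', s6'] at key
  have hcs : (∑ x, F x)^2 ≤ Fintype.card V * ∑ x, F x^2 := by
    simpa using sq_sum_le_card_mul_sum_sq (s := Finset.univ) (f := F)
  have hS0 : 0 ≤ ∑ x, F x := Finset.sum_nonneg fun x _ => hF x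
  unfold Lam
  set N : ℝ := (Fintype.card V : ℝ)
  set L := ∑ x, ∑ y, F x * F y * F (y + y - x)
  set S := ∑ x, F x
  set S2 := ∑ x, F x ^ 2
  set S3 := ∑ x, F x ^ 3
  have k2 : 2 * S * S2 ≤ N * S3 + L := by
    have : ∑ x : V, N * F x ^ 3 = N * S3 := t1'
    simp only [this, t2, t3] at key
    linarith
  have k3 : 2 * S^3 ≤ N * (N * S3 + L) := by
    nlinarith [mul_le_mul_of_nonneg_left hcs hS0]
  have : S3 / N + L / N^2 - 2 * (S/N)^3 = (N * (N * S3 + L) - 2 * S^3) / N^3 := by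
    field_simp
  have h0 : 0 ≤ (N * (N * S3 + L) - 2 * S^3) / N^3 := div_nonneg (by linarith) (by positivity)
  linarith
end

lemma avgCoset_eq {p n : ℕ} [NeZero p] (K : Submodule (ZMod p) (Fin n → ZMod p)) [Fintype K]
    (f : (Fin n → ZMod p) → ℝ) (g : Fin n → ZMod p) :
    avgCoset K f g = (∑ y : K, f (g + y)) / (Fintype.card K : ℝ) := by
  unfold avgCoset
  rw [Nat.card_eq_fintype_card]
  congr!

lemma sum_avgW {p : ℕ} [Fact p.Prime] {V : Type*} [AddCommGroup V] [Module (ZMod p) V] [Fintype V]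
    (W : Submodule (ZMod p) V) [Fintype W] (F : V → ℝ) : ∑ v, avgW W F v = ∑ v, F v := by
  unfold avgW
  have hW : (Fintype.card W : ℝ) ≠ 0 := by simp
  rw [← Finset.sum_div, Finset.sum_comm, div_eq_iff hW]
  have : ∀ w : W, ∑ v, F (v + w) = ∑ v, F v := fun w =>
    Equiv.sum_comp (Equiv.addRight (w : V)) F
  simp [this, mul_comm]

lemma avgW_map {p n : ℕ} [Fact p.Prime] (H : Submodule (ZMod p) (Fin n → ZMod p)) 
    (W : Submodule (ZMod p) H) [Fintype W] (f : (Fin n → ZMod p) → ℝ) (g : Fin n → ZMod p) (h : H) :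
    avgW W (fun h : H => f (g + h)) h = avgCoset (W.map H.subtype) f (g + h) := by
  classical
  let e := Submodule.equivMapOfInjective H.subtype H.injective_subtype W
  letI : Fintype (W.map H.subtype) := Fintype.ofEquiv W e.toEquiv
  rw [avgCoset_eq]
  unfold avgW
  rw [← Fintype.card_congr e.toEquiv, ← Equiv.sum_comp e.toEquiv]
  congr 1
  refine Finset.sum_congr rfl fun w _ => ?_
  simp [e, add_assoc]

lemma sum_mean_shift {p n : ℕ} [Fact p.Prime] (H : Submodule (ZMod p) (Fin n → ZMod p)) [Fintype H]
    (A : (Fin n → ZMod p) → ℝ) :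
    ∑ g, (∑ h : H, A (g + h)) / (Fintype.card H : ℝ) = ∑ g, A g := by
  have hW : (Fintype.card H : ℝ) ≠ 0 := by simp
  rw [← Finset.sum_div, Finset.sum_comm, div_eq_iff hW]
  have : ∀ w : H, ∑ v, A (v + w) = ∑ v, A v := fun w =>
    Equiv.sum_comp (Equiv.addRight (w : Fin n → ZMod p)) A
  simp [this, mul_comm]

lemma two_ne {p : ℕ} [Fact p.Prime] (hodd : Odd p) : (2 : ZMod p) ≠ 0 := by
  intro h
  have : ((2 : ℕ) : ZMod p) = 0 := by exact_mod_cast h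
  rw [ZMod.natCast_eq_zero_iff] at this
  have hp := (Nat.prime_dvd_prime_iff_eq (Fact.out : p.Prime) Nat.prime_two).1 this
  subst hp
  exact absurd hodd (by decide)

lemma Lam_le_lam {p n : ℕ} [Fact p.Prime] (hodd : Odd p)
    (H : Submodule (ZMod p) (Fin n → ZMod p)) [Fintype H]
    (f : (Fin n → ZMod p) → ℝ) (hf : ∀ x, f x ∈ Set.Icc (0 : ℝ) 1) (g : Fin n → ZMod p) :
    Lam (fun h : H => f (g + h)) ≤ lamCoset H f g + avgCoset H f g / (Fintype.card H : ℝ) := by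
  classical
  have hf0 : ∀ x, 0 ≤ f x := fun x => (hf x).1
  set F : H → ℝ := fun h : H => f (g + h) with hFdef
  have hN1 : (1 : ℝ) ≤ Fintype.card H := by
    exact_mod_cast Nat.succ_le_of_lt Fintype.card_pos
  rw [avgCoset_eq]
  unfold Lam lamCoset
  rw [Nat.card_eq_fintype_card]
  set T := (Finset.univ :
        Finset ((Fin n → ZMod p) × (Fin n → ZMod p) × (Fin n → ZMod p))).filter
      (fun t => t.1 - g ∈ H ∧ t.2.1 - g ∈ H ∧ t.2.2 - g ∈ H ∧
        t.1 ≠ t.2.1 ∧ t.2.1 ≠ t.2.2 ∧ t.1 ≠ t.2.2 ∧ t.1 - 2 • t.2.1 + t.2.2 = 0) with hT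
  set D : Finset (H × H) := Finset.univ.filter (fun q => q.1 ≠ q.2) with hD
  let m : H × H → (Fin n → ZMod p) × (Fin n → ZMod p) × (Fin n → ZMod p) :=
    fun q => (g + q.1, g + q.2, g + (q.2 + q.2 - q.1 : H))
  have hd2 : ∀ a : Fin n → ZMod p, a + a = 0 → a = 0 := by
    intro a ha
    rw [← two_smul (ZMod p)] at ha
    exact (smul_eq_zero.1 ha).resolve_left (two_ne hodd)
  have hm : Set.InjOn m D := by
    rintro ⟨a, b⟩ _ ⟨c, d⟩ _ h
    simp only [m, Prod.mk.injEq, add_right_inj, SetLike.coe_eq_coe] at h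
    simp [h.1, h.2.1]
  have hsub : D.image m ⊆ T := by
    intro t ht
    obtain ⟨⟨a, b⟩, hab, rfl⟩ := Finset.mem_image.1 ht
    have hab' : (a : Fin n → ZMod p) ≠ b := by simpa [hD] using hab
    simp only [hT, m, Finset.mem_filter, Finset.mem_univ, true_and, add_sub_cancel_left,
      SetLike.coe_mem]
    refine ⟨?_, ?_, ?_, ?_⟩
    · simpa using hab'
    · intro h
      apply hab'
      have := add_left_cancel h
      push_cast at this
      have h3 : (b : Fin n → ZMod p) - a = 0 := by
        linear_combination (exp := 1) -this
      exact (sub_eq_zero.1 h3).symm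
    · intro h
      apply hab'
      have := add_left_cancel h
      push_cast at this
      have h3 : (b : Fin n → ZMod p) - a = 0 := by
        apply hd2
        linear_combination (exp := 1) -this
      exact (sub_eq_zero.1 h3).symm
    · push_cast
      rw [two_nsmul]
      abel
  have h1 : ∑ q ∈ D, F q.1 * F q.2 * F (q.2 + q.2 - q.1) ≤ ∑ t ∈ T, f t.1 * f t.2.1 * f t.2.2 := by
    calc _ = ∑ t ∈ D.image m, f t.1 * f t.2.1 * f t.2.2 := by
          rw [Finset.sum_image hm]
      _ ≤ _ := Finset.sum_le_sum_of_subset_of_nonneg hsub fun t _ _ =>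
          mul_nonneg (mul_nonneg (hf0 _) (hf0 _)) (hf0 _)
  have h2 : ∑ x, ∑ y, F x * F y * F (y + y - x) =
      ∑ q ∈ D, F q.1 * F q.2 * F (q.2 + q.2 - q.1) + ∑ x, F x ^ 3 := by
    rw [← Fintype.sum_prod_type' (f := fun x y => F x * F y * F (y + y - x)),
      ← Finset.sum_filter_add_sum_filter_not Finset.univ (fun q : H × H => q.1 ≠ q.2)]
    congr 1
    symm
    refine Finset.sum_bij (fun x _ => (x, x)) ?_ ?_ ?_ ?_
    · simp
    · simp
    · rintro ⟨a, b⟩ h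
      simp at h
      subst h
      exact ⟨a, by simp⟩
    · intro a _
      simp
      ring
  have h3 : ∑ x, F x ^ 3 ≤ ∑ x, F x := Finset.sum_le_sum fun x _ => by
    have := hf (g + x)
    exact pow_le_of_le_one this.1 this.2 (by norm_num)
  have h4 : ∑ q ∈ D, F q.1 * F q.2 * F (q.2 + q.2 - q.1) ≤
      (∑ t ∈ T, f t.1 * f t.2.1 * f t.2.2) / ((Fintype.card H : ℝ) * ((Fintype.card H : ℝ) - 1)) *
        (Fintype.card H : ℝ) ^ 2 := by
    have hT0 : 0 ≤ ∑ t ∈ T, f t.1 * f t.2.1 * f t.2.2 := Finset.sum_nonneg fun t _ =>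
          mul_nonneg (mul_nonneg (hf0 _) (hf0 _)) (hf0 _)
    rcases hN1.eq_or_lt with h | h
    · have hc : Fintype.card H = 1 := by exact_mod_cast h.symm
      have hs : Subsingleton H := Fintype.card_le_one_iff_subsingleton.1 hc.le
      have : D = ∅ := by
        rw [hD]
        ext q
        simp [Subsingleton.elim q.1 q.2]
      rw [this, ← h]
      simp
    · refine h1.trans ?_
      rw [div_mul_eq_mul_div, le_div_iff₀ (by nlinarith)]
      apply mul_le_mul_of_nonneg_left _ hT0
      nlinarith
  rw [h2, div_le_iff₀ (by positivity), add_mul]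
  have h5 : (∑ y : H, f (g + y)) / (Fintype.card H : ℝ) / (Fintype.card H : ℝ) *
      (Fintype.card H : ℝ) ^ 2 = ∑ x, F x := by
    field_simp
    rfl
  rw [h5]
  linarith

theorem mean_cube_density_increment (p : ℕ) [Fact p.Prime] (hodd : Odd p) (n : ℕ)
    (ε α : ℝ) (hε : 0 < ε) (f : (Fin n → ZMod p) → ℝ)
    (hf : ∀ x, f x ∈ Set.Icc (0 : ℝ) 1) (hα : (∑ x, f x) / (p : ℝ) ^ n = α)
    (H : Submodule (ZMod p) (Fin n → ZMod p)) (hH : 4 * α / ε < (Nat.card H : ℝ))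
    (hcodim : ((n - Module.finrank (ZMod p) H : ℕ) : ℝ) +
        (p : ℝ) ^ (n - Module.finrank (ZMod p) H) * 144 / ε ^ 2 ≤ n)
    (hap : (∑ g : Fin n → ZMod p, lamCoset H f g) / (p : ℝ) ^ n < α ^ 3 - ε) :
    ∃ H' : Submodule (ZMod p) (Fin n → ZMod p), H' ≤ H ∧
      ((n - Module.finrank (ZMod p) H' : ℕ) : ℝ) ≤
        ((n - Module.finrank (ZMod p) H : ℕ) : ℝ) +
          (p : ℝ) ^ (n - Module.finrank (ZMod p) H) * 144 / ε ^ 2 ∧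
      meanCube H' f - α ^ 3 > 2 * (meanCube H f - α ^ 3) + ε / 2 := by
  classical
  letI : Fintype H := Fintype.ofFinite H
  haveI : Finite (Module.Dual (ZMod p) H) := finDual
  letI : Fintype (Module.Dual (ZMod p) H) := Fintype.ofFinite _
  have hp0 : (0 : ℝ) < p := by exact_mod_cast (Fact.out : p.Prime).pos
  have hN : (0 : ℝ) < (p : ℝ) ^ n := by positivity
  have hM : (0 : ℝ) < Fintype.card H := by exact_mod_cast Fintype.card_pos
  rw [Nat.card_eq_fintype_card] at hH
  set F : (Fin n → ZMod p) → H → ℝ := fun g h => f (g + h) with hFdef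
  have hF : ∀ g h, F g h ∈ Set.Icc (0:ℝ) 1 := fun g h => hf _
  have hshift : ∀ g (h : H) (φ : Module.Dual (ZMod p) H), ‖hatF (F (g + h)) φ‖ = ‖hatF (F g) φ‖ := by
    intro g h φ
    have : F (g + h) = fun v => F g (v + h) := by
      funext v
      simp only [hFdef]
      congr 1
      push_cast
      abel
    rw [this, hat_shift, norm_mul, chi_norm, mul_one]
  set S : Finset (Module.Dual (ZMod p) H) :=
    Finset.univ.filter (fun φ => ∃ g, ε / 12 < ‖hatF (F g) φ‖) with hS
  let P : H →ₗ[ZMod p] (S → ZMod p) := LinearMap.pi (fun φ : S => φ.1)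
  set W : Submodule (ZMod p) H := LinearMap.ker P with hW
  letI : Fintype W := Fintype.ofFinite W
  have hWS : ∀ φ ∈ S, W ≤ LinearMap.ker φ := by
    intro φ hφ w hw
    have : P w = 0 := hw
    exact congrFun this ⟨φ, hφ⟩
  have hcardH : (Fintype.card H : ℝ) = (p : ℝ) ^ Module.finrank (ZMod p) H := by
    rw [Module.card_eq_pow_finrank (K := ZMod p), ZMod.card]; push_cast; rfl
  have hfr : Module.finrank (ZMod p) H ≤ n := by
    simpa using Submodule.finrank_le H
  -- size of S
  have hpars : ∀ g, ∑ φ : Module.Dual (ZMod p) H, ‖hatF (F g) φ‖ ^ 2 ≤ 1 := by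
    intro g
    rw [parseval]
    apply div_le_one_of_le₀ _ (by positivity)
    calc ∑ v, F g v ^ 2 ≤ ∑ v : H, (1:ℝ) := Finset.sum_le_sum fun v _ => by
          have := hF g v
          exact pow_le_one₀ this.1 this.2
      _ = _ := by simp
  have hScard : (S.card : ℝ) ≤ (p : ℝ) ^ (n - Module.finrank (ZMod p) H) * 144 / ε ^ 2 := by
    have a1 : ∀ φ ∈ S, (Fintype.card H : ℝ) * (ε / 12) ^ 2 ≤ ∑ g, ‖hatF (F g) φ‖ ^ 2 := by
      intro φ hφ
      obtain ⟨g, hg⟩ := (Finset.mem_filter.1 hφ).2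
      have inj : Function.Injective (fun h : H => g + (h : Fin n → ZMod p)) := by
        intro a b hab
        exact Subtype.ext (add_left_cancel hab)
      calc (Fintype.card H : ℝ) * (ε / 12) ^ 2 = ∑ h : H, (ε / 12) ^ 2 := by simp
        _ ≤ ∑ h : H, ‖hatF (F (g + h)) φ‖ ^ 2 := Finset.sum_le_sum fun h _ => by
            rw [hshift]
            gcongr
        _ = ∑ x ∈ Finset.univ.image (fun h : H => g + (h : Fin n → ZMod p)), ‖hatF (F x) φ‖ ^ 2 := by
            rw [Finset.sum_image inj.injOn]
        _ ≤ _ := Finset.sum_le_sum_of_subset_of_nonneg (Finset.subset_univ _) fun _ _ _ => by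
            positivity
    have a2 : (S.card : ℝ) * ((Fintype.card H : ℝ) * (ε / 12) ^ 2) ≤ (p : ℝ) ^ n := by
      calc (S.card : ℝ) * ((Fintype.card H : ℝ) * (ε / 12) ^ 2)
          = ∑ φ ∈ S, (Fintype.card H : ℝ) * (ε / 12) ^ 2 := by simp
        _ ≤ ∑ φ ∈ S, ∑ g, ‖hatF (F g) φ‖ ^ 2 := Finset.sum_le_sum a1
        _ ≤ ∑ φ, ∑ g, ‖hatF (F g) φ‖ ^ 2 :=
            Finset.sum_le_sum_of_subset_of_nonneg (Finset.subset_univ _) fun _ _ _ => by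
              positivity
        _ = ∑ g, ∑ φ, ‖hatF (F g) φ‖ ^ 2 := Finset.sum_comm
        _ ≤ ∑ g : Fin n → ZMod p, (1 : ℝ) := Finset.sum_le_sum fun g _ => hpars g
        _ = _ := by simp [ZMod.card]
    have a3 : (p : ℝ) ^ n = (p : ℝ) ^ (n - Module.finrank (ZMod p) H) * (Fintype.card H : ℝ) := by
      rw [hcardH, ← pow_add, Nat.sub_add_cancel hfr]
    rw [a3] at a2
    rw [le_div_iff₀ (by positivity)]
    have : (S.card : ℝ) * (ε / 12) ^ 2 ≤ (p : ℝ) ^ (n - Module.finrank (ZMod p) H) := by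
      apply le_of_mul_le_mul_right _ hM
      linarith
    linarith
  refine ⟨W.map H.subtype, Submodule.map_subtype_le H W, ?_, ?_⟩
  · have b1 : Module.finrank (ZMod p) (W.map H.subtype) = Module.finrank (ZMod p) W :=
      LinearEquiv.finrank_eq
        (Submodule.equivMapOfInjective H.subtype H.injective_subtype W).symm
    have b2 := LinearMap.finrank_range_add_finrank_ker P
    have b3 : Module.finrank (ZMod p) (LinearMap.range P) ≤ S.card := by
      have := Submodule.finrank_le (LinearMap.range P)
      simpa using this
    have b4 : n - Module.finrank (ZMod p) (W.map H.subtype) ≤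
        (n - Module.finrank (ZMod p) H) + S.card := by
      rw [b1]
      rw [← hW] at b2
      omega
    have b5 : ((n - Module.finrank (ZMod p) (W.map H.subtype) : ℕ) : ℝ) ≤
        ((n - Module.finrank (ZMod p) H : ℕ) : ℝ) + S.card := by exact_mod_cast b4
    linarith
  · have c1 : ∀ g, Lam (avgW W (F g)) ≤ Lam (F g) + ε / 12 := by
      intro g
      apply lam_diff hodd _ _ _ (by positivity) (hF g)
      intro φ hφ
      by_contra hcon
      exact hφ (hWS φ (Finset.mem_filter.2 ⟨Finset.mem_univ _, g, not_le.1 hcon⟩))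
    have c2 : ∀ g, Lam (F g) ≤ lamCoset H f g + avgCoset H f g / (Fintype.card H : ℝ) :=
      fun g => Lam_le_lam hodd H f hf g
    have c3 : ∀ g, 2 * avgCoset H f g ^ 3 ≤
        (∑ h : H, avgCoset (W.map H.subtype) f (g + h) ^ 3) / (Fintype.card H : ℝ) +
          Lam (avgW W (F g)) := by
      intro g
      have := schur_avg (p := p) hodd (fun v : H => by
        rw [← Nat.cast_smul_eq_nsmul (ZMod p)]; simp) (avgW W (F g)) (fun v => by
          unfold avgW
          exact div_nonneg (Finset.sum_nonneg fun w _ => (hF _ _).1) (by positivity))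
      rw [sum_avgW] at this
      rw [avgCoset_eq H]
      simp only [hFdef, avgW_map] at this ⊢
      exact this
    have c4 : ∑ g, avgCoset H f g = ∑ g, f g := by
      simp only [avgCoset_eq H]
      exact sum_mean_shift H f
    have c5 := sum_mean_shift H (fun g => avgCoset (W.map H.subtype) f g ^ 3)
    have c6 : ∑ g, 2 * avgCoset H f g ^ 3 ≤
      ∑ g, ((∑ h : H, avgCoset (W.map H.subtype) f (g + h) ^ 3) / (Fintype.card H : ℝ) +
        ((lamCoset H f g + avgCoset H f g / (Fintype.card H : ℝ)) + ε / 12)) :=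
      Finset.sum_le_sum fun g _ => by linarith [c1 g, c2 g, c3 g]
    simp only [Finset.sum_add_distrib, ← Finset.mul_sum, ← Finset.sum_div] at c5 c6
    rw [c5, c4] at c6
    have c7 : ∑ g : Fin n → ZMod p, ε = (p : ℝ) ^ n * ε := by simp [ZMod.card]
    rw [c7] at c6
    have hα' : ∑ x, f x = α * (p : ℝ) ^ n := by rw [← hα]; field_simp
    rw [hα'] at c6
    have hap' := (div_lt_iff₀ hN).1 hap
    have d1 : α * (p : ℝ) ^ n / (Fintype.card H : ℝ) ≤ ε / 4 * (p : ℝ) ^ n := by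
      rw [div_le_iff₀ hM]
      rw [div_lt_iff₀ hε] at hH
      nlinarith
    unfold meanCube
    set A := ∑ g, avgCoset H f g ^ 3
    set B := ∑ g, avgCoset (W.map H.subtype) f g ^ 3
    have d2 : 2 * A + (ε / 2 - α ^ 3) * (p : ℝ) ^ n < B := by
      have : 0 < ε * (p : ℝ) ^ n := by positivity
      linarith
    have d3 : (2 * A + (ε / 2 - α ^ 3) * (p : ℝ) ^ n) / (p : ℝ) ^ n < B / (p : ℝ) ^ n := by
      gcongr
    have d4 : (2 * A + (ε / 2 - α ^ 3) * (p : ℝ) ^ n) / (p : ℝ) ^ n =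
      2 * (A / (p : ℝ) ^ n) + (ε / 2 - α ^ 3) := by field_simp
    linarith
end

section
/- Let p be an odd prime, M ≥ 0, and t : 𝔽_p^M → [0,1] a function with average α = 𝔼_k[t(k)]. Let C = {(k₁, k₂, k₃) ∈ (𝔽_p^M)³ : k₁ − 2k₂ + k₃ = 0}. Then 𝔼_{(k₁,k₂,k₃) ∈ C}[ t(k₁)³ + t(k₂)³ + t(k₃)³ + 3·t(k₁)t(k₂)t(k₃) ] ≥ 6α³. -/
theorem schur_aux (a b c : ℝ) (ha : 0 ≤ a) (hb : 0 ≤ b) (hc : 0 ≤ c) :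
    a ^ 2 * b + b ^ 2 * a + (a ^ 2 * c + c ^ 2 * a) + (b ^ 2 * c + c ^ 2 * b) ≤
      a ^ 3 + b ^ 3 + c ^ 3 + 3 * (a * b * c) := by
  rcases le_total a b with h1 | h1 <;> rcases le_total b c with h2 | h2 <;>
    rcases le_total a c with h3 | h3 <;>
    nlinarith [mul_nonneg (sub_nonneg.2 h1) (sub_nonneg.2 h2),
      mul_nonneg (sub_nonneg.2 h1) (sub_nonneg.2 h3),
      mul_nonneg (sub_nonneg.2 h2) (sub_nonneg.2 h3),
      mul_nonneg ha (mul_nonneg (sub_nonneg.2 h1) (sub_nonneg.2 h3)),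
      mul_nonneg hb (mul_nonneg (sub_nonneg.2 h1) (sub_nonneg.2 h2)),
      mul_nonneg hc (mul_nonneg (sub_nonneg.2 h2) (sub_nonneg.2 h3)),
      mul_nonneg (sub_nonneg.2 h1) (sq_nonneg (a - b)),
      mul_nonneg ha (sq_nonneg (b - c)), mul_nonneg hb (sq_nonneg (a - c)),
      mul_nonneg hc (sq_nonneg (a - b)),
      mul_nonneg (sub_nonneg.2 h1) (mul_nonneg (sub_nonneg.2 h2) (sub_nonneg.2 h3)),
      mul_nonneg (sub_nonneg.2 h1) (sq_nonneg (a + b - c)),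
      mul_nonneg (sub_nonneg.2 h2) (sq_nonneg (b + c - a)),
      mul_nonneg (sub_nonneg.2 h3) (sq_nonneg (a + c - b))]

/-- Schur inequality consequence. Let `p` be an odd prime, `M ≥ 0`,
and `t : 𝔽_p^M → [0,1]` with average `α`. Let `C` be the set of ordered triples
`(k₁, k₂, k₃)` with `k₁ - 2k₂ + k₃ = 0` (so `k₃ = 2k₂ - k₁`, and `|C| = p^{2M}`). Then
`𝔼_{(k₁,k₂,k₃) ∈ C}[t(k₁)³ + t(k₂)³ + t(k₃)³ + 3 t(k₁) t(k₂) t(k₃)] ≥ 6α³`. -/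
theorem schur_ap_inequality (p : ℕ) [Fact p.Prime] (hodd : Odd p) (M : ℕ)
    (t : (Fin M → ZMod p) → ℝ) (ht : ∀ k, t k ∈ Set.Icc (0 : ℝ) 1) (α : ℝ)
    (hα : (∑ k, t k) / (p : ℝ) ^ M = α) :
    (∑ k₁ : Fin M → ZMod p, ∑ k₂ : Fin M → ZMod p,
        (t k₁ ^ 3 + t k₂ ^ 3 + t (2 • k₂ - k₁) ^ 3 +
          3 * (t k₁ * t k₂ * t (2 • k₂ - k₁)))) / (p : ℝ) ^ (2 * M) ≥ 6 * α ^ 3 := by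
  have h0 : ∀ k, 0 ≤ t k := fun k => (ht k).1
  have hp : (0 : ℝ) < p := by exact_mod_cast (Fact.out : p.Prime).pos
  have h2 : (2 : ZMod p) ≠ 0 := by
    intro h
    have h' : ((2 : ℕ) : ZMod p) = 0 := by exact_mod_cast h
    rw [ZMod.natCast_eq_zero_iff] at h'
    have := (Nat.prime_dvd_prime_iff_eq (Fact.out : p.Prime) Nat.prime_two).1 h'
    subst this
    exact absurd hodd (by decide)
  have hsmul : ∀ k : Fin M → ZMod p, 2 • k = (2 : ZMod p) • k := by
    intro k; rw [two_nsmul, two_smul]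
  have e1 : ∀ (g : (Fin M → ZMod p) → ℝ) (k₁ : Fin M → ZMod p),
      ∑ k₂, g (2 • k₂ - k₁) = ∑ k, g k := by
    intro g k₁
    refine Function.Bijective.sum_comp (Finite.injective_iff_bijective.1 ?_) g
    intro x y hxy
    simp only [sub_left_inj, hsmul] at hxy
    exact smul_right_injective _ h2 hxy
  have e2 : ∀ (g : (Fin M → ZMod p) → ℝ) (k₂ : Fin M → ZMod p),
      ∑ k₁, g (2 • k₂ - k₁) = ∑ k, g k := by
    intro g k₂
    exact (Equiv.subLeft (2 • k₂)).sum_comp g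
  set S := ∑ k, t k with hS
  set Q := ∑ k, t k ^ 2 with hQ
  have A : ∀ f g : (Fin M → ZMod p) → ℝ,
      ∑ k₁, ∑ k₂, f k₁ * g k₂ = (∑ k, f k) * ∑ k, g k := by
    intro f g; rw [Finset.sum_mul_sum]
  have B : ∀ f g : (Fin M → ZMod p) → ℝ,
      ∑ k₁, ∑ k₂, f k₁ * g (2 • k₂ - k₁) = (∑ k, f k) * ∑ k, g k := by
    intro f g
    simp only [← Finset.mul_sum, e1, ← Finset.sum_mul]
  have C : ∀ f g : (Fin M → ZMod p) → ℝ,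
      ∑ k₁, ∑ k₂, f k₂ * g (2 • k₂ - k₁) = (∑ k, f k) * ∑ k, g k := by
    intro f g
    rw [Finset.sum_comm]
    simp only [← Finset.mul_sum, e2, ← Finset.sum_mul]
  have key : 6 * (Q * S) ≤ ∑ k₁ : Fin M → ZMod p, ∑ k₂ : Fin M → ZMod p,
        (t k₁ ^ 3 + t k₂ ^ 3 + t (2 • k₂ - k₁) ^ 3 +
          3 * (t k₁ * t k₂ * t (2 • k₂ - k₁))) := by
    have a1 := A (fun k => t k ^ 2) t
    have a2 := A t (fun k => t k ^ 2)
    have b1 := B (fun k => t k ^ 2) t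
    have b2 := B t (fun k => t k ^ 2)
    have c1 := C (fun k => t k ^ 2) t
    have c2 := C t (fun k => t k ^ 2)
    have := Finset.sum_le_sum (s := Finset.univ) fun (k₁ : Fin M → ZMod p) _ =>
      Finset.sum_le_sum (s := Finset.univ) fun (k₂ : Fin M → ZMod p) _ =>
        schur_aux (t k₁) (t k₂) (t (2 • k₂ - k₁)) (h0 _) (h0 _) (h0 _)
    refine le_trans (le_of_eq ?_) this
    simp only [Finset.sum_add_distrib]
    simp only [mul_comm (t _ ^ 2) (t _)] at *
    simp only [a2, b2, c2, a1, b1, c1] 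
    ring
  have cs : S ^ 2 ≤ (p : ℝ) ^ M * Q := by
    have := sq_sum_le_card_mul_sum_sq (s := (Finset.univ : Finset (Fin M → ZMod p))) (f := t)
    simpa [ZMod.card] using this
  have hS0 : 0 ≤ S := Finset.sum_nonneg fun k _ => h0 k
  have hN : (0 : ℝ) < (p : ℝ) ^ M := pow_pos hp M
  rw [ge_iff_le, ← hα, le_div_iff₀ (by positivity), mul_comm 2 M, pow_mul]
  refine le_trans ?_ key
  have : 6 * (S / (p : ℝ) ^ M) ^ 3 * ((p : ℝ) ^ M) ^ 2 = 6 * (S ^ 2 / (p : ℝ) ^ M * S) := by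
    field_simp
  rw [this]
  have : S ^ 2 / (p : ℝ) ^ M ≤ Q := by
    rw [div_le_iff₀ hN]; linarith
  gcongr
end

section
/- Let p be a prime, f : 𝔽_p^n → [0,1], and let H' ⊆ H be subspaces of 𝔽_p^n. Then b(H') ≥ b(H), where b(K) = 𝔼_{g ∈ 𝔽_p^n}[(𝔼_{y ∈ K+g} f(y))³] is the mean cube density of f with respect to the subspace K. -/
/-- Let `p` be a prime, `f : 𝔽_p^n → [0,1]`, and `H' ⊆ H` subspaces
of `𝔽_p^n`. Then `b(H') ≥ b(H)`. -/
theorem meanCube_mono (p : ℕ) [Fact p.Prime] (n : ℕ) (f : (Fin n → ZMod p) → ℝ)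
    (hf : ∀ x, f x ∈ Set.Icc (0 : ℝ) 1)
    (H' H : Submodule (ZMod p) (Fin n → ZMod p)) (hsub : H' ≤ H) :
    meanCube H' f ≥ meanCube H f := by
  unfold meanCube
  apply div_le_div_of_nonneg_right _ (by positivity)
  letI i1 : Fintype H := Fintype.ofFinite H
  letI i2 : Fintype H' := Fintype.ofFinite H'
  have e : ∀ g, avgCoset H f g = (∑ h : H, f (g + h)) / (Nat.card H : ℝ) := fun g => rfl
  have e' : ∀ g, avgCoset H' f g = (∑ h : H', f (g + h)) / (Nat.card H' : ℝ) := fun g => rfl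
  have c : (0 : ℝ) < Nat.card H := by exact_mod_cast Nat.card_pos
  have c' : (0 : ℝ) < Nat.card H' := by exact_mod_cast Nat.card_pos
  have pos : ∀ g, 0 ≤ avgCoset H' f g := fun g => by
    rw [e']
    exact div_nonneg (Finset.sum_nonneg fun x _ => (hf _).1) c'.le
  have key : ∀ g, avgCoset H f g = (∑ h : H, avgCoset H' f (g + h)) / (Nat.card H : ℝ) := by
    intro g
    rw [e]
    congr 1
    simp_rw [e']
    rw [← Finset.sum_div, Finset.sum_comm, eq_div_iff c'.ne']
    have : ∀ k : H', ∑ h : H, f (g + h + k) = ∑ h : H, f (g + h) := by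
      intro k
      refine Fintype.sum_equiv (Equiv.addRight (⟨k, hsub k.2⟩ : H)) _ _ fun h => ?_
      simp [add_assoc]
    simp_rw [this]
    simp [mul_comm, Nat.card_eq_fintype_card]
  have jen : ∀ g, avgCoset H f g ^ 3 ≤ (∑ h : H, avgCoset H' f (g + h) ^ 3) / (Nat.card H : ℝ) := by
    intro g
    have h := pow_sum_div_card_le_sum_pow (s := (Finset.univ : Finset H))
      (f := fun h => avgCoset H' f (g + h)) (fun _ _ => pos _) 2
    rw [Finset.card_univ, ← Nat.card_eq_fintype_card] at h
    rw [key, div_pow, le_div_iff₀ c]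
    refine le_trans (le_of_eq ?_) h
    field_simp
  refine (Finset.sum_le_sum fun g _ => jen g).trans (le_of_eq ?_)
  rw [← Finset.sum_div, Finset.sum_comm, div_eq_iff c.ne']
  have : ∀ k : H, ∑ g, avgCoset H' f (g + k) ^ 3 = ∑ g, avgCoset H' f g ^ 3 := fun k =>
    Fintype.sum_equiv (Equiv.addRight (k : Fin n → ZMod p)) _ _ fun h => rfl
  simp_rw [this]
  simp [mul_comm, Nat.card_eq_fintype_card]
end
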